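/- Let n ≥ 2 be an integer. There is no C² function u : ℝⁿ → ℝ such that for every x ∈ ℝⁿ: S_l(W(u)(x)) > 0 for all l = 1, …, n, and S_n(W(u)(x)) · √(1 + |∇u(x)|²) = S_{n−1}(W(u)(x)). That is, there are no entire graphical Q_{n−1}-translators in ℝ^{n+1} whose principal curvatures belong to the cone Γ_n. -/

import Mathlib

open scoped Matrix

/-- `i`-th partial derivative `∂ᵢ u x`. -/
noncomputable def partialDeriv1 {n : ℕ} (u : EuclideanSpace ℝ (Fin n) → ℝ)
    (x : EuclideanSpace ℝ (Fin n)) (i : Fin n) : ℝ :=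
  fderiv ℝ u x (EuclideanSpace.single i 1)

/-- Hessian matrix `∂ᵢ∂ⱼ u x`. -/
noncomputable def hessianMatrix {n : ℕ} (u : EuclideanSpace ℝ (Fin n) → ℝ)
    (x : EuclideanSpace ℝ (Fin n)) : Matrix (Fin n) (Fin n) ℝ :=
  Matrix.of fun i j =>
    fderiv ℝ (fun y => fderiv ℝ u y (EuclideanSpace.single j 1)) x (EuclideanSpace.single i 1)

/-- Squared Euclidean norm of the gradient, `|∇u x|²`. -/
noncomputable def gradNormSq {n : ℕ} (u : EuclideanSpace ℝ (Fin n) → ℝ)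
    (x : EuclideanSpace ℝ (Fin n)) : ℝ :=
  ∑ i, (partialDeriv1 u x i) ^ 2

/-- The Weingarten matrix of the graph of `u`,
`Wⁱⱼ = Σₖ (δᵢₖ/√(1+|∇u|²) − ∂ᵢu ∂ₖu/(1+|∇u|²)^{3/2}) ∂ₖ∂ⱼu`. -/
noncomputable def weingartenMatrix {n : ℕ} (u : EuclideanSpace ℝ (Fin n) → ℝ)
    (x : EuclideanSpace ℝ (Fin n)) : Matrix (Fin n) (Fin n) ℝ :=
  Matrix.of fun i j =>
    ∑ k, ((if i = k then (1 : ℝ) else 0) / Real.sqrt (1 + gradNormSq u x) -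
        partialDeriv1 u x i * partialDeriv1 u x k / (Real.sqrt (1 + gradNormSq u x)) ^ 3) *
      hessianMatrix u x k j

/-- `S_l(W)`, the `l`-th elementary symmetric function of the eigenvalues of `W`,
defined via `det(I + t W) = Σ_l S_l(W) tˡ`. -/
noncomputable def symFunc {n : ℕ} (W : Matrix (Fin n) (Fin n) ℝ) (l : ℕ) : ℝ :=
  (Matrix.det (1 + (Polynomial.X : Polynomial ℝ) • W.map Polynomial.C)).coeff l

open Polynomial in
/-- The elementary symmetric functions do not depend on the order of a product of matrices. -/
lemma symFunc_mul_comm {n : ℕ} (A B : Matrix (Fin n) (Fin n) ℝ) (l : ℕ) :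
    symFunc (A * B) l = symFunc (B * A) l := by
  unfold symFunc
  rw [Matrix.map_mul, Matrix.map_mul, ← Matrix.smul_mul, Matrix.det_one_add_mul_comm,
    Matrix.mul_smul]

open Polynomial in
lemma symFunc_diagonal {n : ℕ} (d : Fin n → ℝ) (l : ℕ) :
    symFunc (Matrix.diagonal d) l = (∏ i, (1 + X * C (d i))).coeff l := by
  unfold symFunc
  have h : (1 + (X : ℝ[X]) • (Matrix.diagonal d).map C) =
      Matrix.diagonal fun i => 1 + X * C (d i) := by
    ext1 i j
    by_cases hij : i = j
    · subst hij; simp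
    · simp [hij]
  rw [h, Matrix.det_diagonal]

open Polynomial in
/-- Real numbers whose elementary symmetric functions are all positive are positive. -/
lemma pos_of_coeff_prod_pos {n : ℕ} (d : Fin n → ℝ)
    (hpos : ∀ l, 1 ≤ l → l ≤ n → 0 < (∏ i, (1 + X * C (d i))).coeff l) (i : Fin n) :
    0 < d i := by
  set P : ℝ[X] := ∏ i, (1 + X * C (d i)) with hP
  have hdeg : P.natDegree ≤ n := by
    refine (natDegree_prod_le _ _).trans ((Finset.sum_le_card_nsmul _ _ 1 fun j _ => ?_).trans ?_)
    · compute_degree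
    · simp
  have h0 : P.coeff 0 = 1 := by
    rw [coeff_zero_eq_eval_zero, hP, eval_prod]; simp
  have heval : ∀ s : ℝ, 0 ≤ s → 0 < P.eval s := by
    intro s hs
    rw [eval_eq_sum_range' (Nat.lt_succ_of_le hdeg), Finset.sum_range_succ', h0]
    have : 0 ≤ ∑ k ∈ Finset.range n, P.coeff (k + 1) * s ^ (k + 1) :=
      Finset.sum_nonneg fun k hk => mul_nonneg
        (hpos _ (by omega) (by have := Finset.mem_range.1 hk; omega)).le (by positivity)
    simpa using by linarith
  have hfac : P = (1 + X * C (d i)) * ∏ j ∈ Finset.univ.erase i, (1 + X * C (d j)) :=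
    (Finset.mul_prod_erase _ _ (Finset.mem_univ i)).symm
  rcases lt_trichotomy (d i) 0 with h | h | h
  · have h1 := heval (-(d i)⁻¹) (by rw [neg_nonneg]; exact (inv_lt_zero.2 h).le)
    rw [hfac, eval_mul] at h1
    simp [h.ne] at h1
  · have h1 := hpos n (by have := i.pos; omega) le_rfl
    have h2 : (P.natDegree) ≤ n - 1 := by
      rw [hfac, h]
      simp only [map_zero, mul_zero, add_zero, one_mul]
      refine (natDegree_prod_le _ _).trans
        ((Finset.sum_le_card_nsmul _ _ 1 fun j _ => ?_).trans ?_)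
      · compute_degree
      · simp
    rw [coeff_eq_zero_of_natDegree_lt (by have := i.pos; omega)] at h1
    exact absurd h1 (lt_irrefl _)
  · exact h

open Polynomial in
/-- If `S_n w = S_{n-1}` for positive `d`, then each `d i` is at least `1 / w`. -/
lemma inv_le_of_coeff_prod_eq {n : ℕ} (hn : 2 ≤ n) (d : Fin n → ℝ) (hd : ∀ i, 0 < d i)
    {w : ℝ} (hw : 0 < w)
    (heq : (∏ i, (1 + X * C (d i))).coeff n * w = (∏ i, (1 + X * C (d i))).coeff (n - 1))
    (i : Fin n) : w⁻¹ ≤ d i := by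
  obtain ⟨m, rfl⟩ := Nat.exists_eq_add_of_le' hn
  set Q : ℝ[X] := ∏ j ∈ Finset.univ.erase i, (1 + X * C (d j)) with hQ
  have hfac : ∏ i, (1 + X * C (d i)) = Q + X * (C (d i) * Q) := by
    rw [← Finset.mul_prod_erase _ _ (Finset.mem_univ i)]; ring
  have hdeg : Q.natDegree ≤ m + 1 := by
    refine (natDegree_prod_le _ _).trans
      ((Finset.sum_le_card_nsmul _ _ 1 fun j _ => ?_).trans ?_)
    · compute_degree
    · simp
  have hnonneg : ∀ k, 0 ≤ Q.coeff k := by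
    rw [hQ]
    refine Finset.prod_induction _ (fun p : ℝ[X] => ∀ k, 0 ≤ p.coeff k) ?_ ?_ ?_
    · intro p q hp hq k
      rw [coeff_mul]
      exact Finset.sum_nonneg fun x _ => mul_nonneg (hp _) (hq _)
    · intro k; rw [coeff_one]; split_ifs <;> norm_num
    · intro j _ k
      rw [coeff_add, coeff_mul_C, coeff_one, coeff_X]
      have := (hd j).le
      split_ifs <;> positivity
  have hlead : Q.coeff (m + 1) = ∏ j ∈ Finset.univ.erase i, d j := by
    have h := coeff_prod_of_natDegree_le (s := Finset.univ.erase i)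
      (fun j => 1 + X * C (d j)) 1 (fun j _ => by compute_degree)
    simpa [hQ, coeff_one] using h
  have hQpos : 0 < Q.coeff (m + 1) := hlead ▸ Finset.prod_pos fun j _ => hd j
  rw [hfac] at heq
  simp only [show m + 2 - 1 = m + 1 by omega, coeff_add, coeff_X_mul, coeff_C_mul] at heq
  rw [coeff_eq_zero_of_natDegree_lt (by omega : Q.natDegree < m + 2)] at heq
  rw [inv_le_iff_one_le_mul₀ hw]
  have h2 := mul_nonneg (hd i).le (hnonneg m)
  by_contra! hlt
  nlinarith

lemma le_of_symFunc_eq {n : ℕ} (hn : 2 ≤ n) {w : ℝ} (hw : 0 < w)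
    {M N H : Matrix (Fin n) (Fin n) ℝ} (hM : Mᵀ = M) (hN : Nᵀ = N) (hH : Hᵀ = H)
    (hMN : M * N = 1)
    (hpos : ∀ l, 1 ≤ l → l ≤ n → 0 < symFunc (w⁻¹ • (N * N * H)) l)
    (heq : symFunc (w⁻¹ • (N * N * H)) n * w = symFunc (w⁻¹ • (N * N * H)) (n - 1))
    (i : Fin n) : (M * M) i i ≤ H i i := by
  have hNM : N * M = 1 := mul_eq_one_comm.1 hMN
  set T := w⁻¹ • (N * H * N) with hT
  have hTH : T.IsHermitian := by
    simp [Matrix.IsHermitian, Matrix.conjTranspose_eq_transpose_of_trivial, hT,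
      Matrix.transpose_mul, hN, hH, mul_assoc]
  set U : Matrix (Fin n) (Fin n) ℝ := hTH.eigenvectorUnitary.1
  set d := hTH.eigenvalues
  have hspec : T = U * Matrix.diagonal d * star U := by
    have h := hTH.spectral_theorem
    rw [Unitary.conjStarAlgAut_apply] at h
    exact h
  have hU : star U * U = 1 := Unitary.coe_star_mul_self _
  have hU' : U * star U = 1 := Unitary.coe_mul_star_self _
  have hsym : ∀ l, symFunc (w⁻¹ • (N * N * H)) l =
      (∏ i, (1 + Polynomial.X * Polynomial.C (d i))).coeff l := by
    intro l
    have h1 : w⁻¹ • (N * N * H) = N * (w⁻¹ • (N * H)) := by simp [mul_assoc]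
    have h2 : w⁻¹ • (N * H) * N = T := by simp [hT]
    rw [h1, symFunc_mul_comm, h2, hspec, mul_assoc, symFunc_mul_comm, mul_assoc, hU, mul_one,
      symFunc_diagonal]
  simp only [hsym] at hpos heq
  have hd := inv_le_of_coeff_prod_eq hn d (pos_of_coeff_prod_pos d hpos) hw heq
  have hpsd : (Matrix.diagonal fun j => d j - w⁻¹).PosSemidef :=
    Matrix.PosSemidef.diagonal fun j => sub_nonneg.2 (hd j)
  have hdiag : (Matrix.diagonal fun j => d j - w⁻¹) = Matrix.diagonal d - w⁻¹ • 1 := by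
    rw [Matrix.smul_one_eq_diagonal, Matrix.diagonal_sub]
  have h3 := hpsd.mul_mul_conjTranspose_same (M * U)
  have h4 : M * U * (Matrix.diagonal fun j => d j - w⁻¹) * (M * U)ᴴ = w⁻¹ • (H - M * M) := by
    have : M * U * (Matrix.diagonal fun j => d j - w⁻¹) * (M * U)ᴴ =
        M * (U * Matrix.diagonal d * star U - w⁻¹ • (U * star U)) * M := by
      rw [hdiag, Matrix.conjTranspose_mul, Matrix.conjTranspose_eq_transpose_of_trivial M, hM,
        Matrix.star_eq_conjTranspose]
      simp [mul_sub, sub_mul, mul_assoc]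
    rw [this, ← hspec, hU', hT, ← smul_sub]
    simp only [mul_smul_comm, smul_mul_assoc, mul_sub, sub_mul, mul_one]
    rw [show M * (N * H * N) * M = (M * N) * H * (N * M) by simp only [mul_assoc], hMN, hNM]
    simp
  rw [h4] at h3
  have h5 := h3.diag_nonneg (i := i)
  rw [Matrix.smul_apply, smul_eq_mul, Matrix.sub_apply] at h5
  have h6 := nonneg_of_mul_nonneg_right h5 (inv_pos.2 hw)
  linarith

/-- A product of two rank-one perturbations of the identity along the same vector. -/
lemma one_add_smul_vecMulVec_mul {n : ℕ} (p : Fin n → ℝ) (a b : ℝ) :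
    (1 + a • Matrix.vecMulVec p p) * (1 + b • Matrix.vecMulVec p p) =
      1 + (a + b + a * b * ∑ i, p i ^ 2) • Matrix.vecMulVec p p := by
  have h : Matrix.vecMulVec p p * Matrix.vecMulVec p p =
      (∑ i, p i ^ 2) • Matrix.vecMulVec p p := by
    rw [Matrix.vecMulVec_mul_vecMulVec]
    ext i j
    simp [Matrix.vecMulVec_apply, dotProduct, sq]
    ring
  rw [add_mul, mul_add, mul_add, one_mul, mul_one, one_mul, smul_mul_smul_comm, h]
  module

lemma hessianMatrix_apply {n : ℕ} {u : EuclideanSpace ℝ (Fin n) → ℝ} (hu : ContDiff ℝ 2 u)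
    (x : EuclideanSpace ℝ (Fin n)) (i j : Fin n) :
    hessianMatrix u x i j =
      fderiv ℝ (fderiv ℝ u) x (EuclideanSpace.single i 1) (EuclideanSpace.single j 1) := by
  have hd : DifferentiableAt ℝ (fderiv ℝ u) x :=
    ((hu.fderiv_right (m := 1) (by norm_num)).differentiable (by norm_num)) x
  unfold hessianMatrix
  rw [Matrix.of_apply, fderiv_clm_apply hd (differentiableAt_const _)]
  simp

lemma hessianMatrix_transpose {n : ℕ} {u : EuclideanSpace ℝ (Fin n) → ℝ} (hu : ContDiff ℝ 2 u)
    (x : EuclideanSpace ℝ (Fin n)) : (hessianMatrix u x)ᵀ = hessianMatrix u x := by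
  ext i j
  rw [Matrix.transpose_apply, hessianMatrix_apply hu, hessianMatrix_apply hu]
  exact hu.contDiffAt.isSymmSndFDerivAt (by simp) _ _

/-- The translator equation forces `∂ᵢ∂ᵢ u ≥ 1 + (∂ᵢ u)²`. -/
lemma one_add_partialDeriv1_sq_le_hessianMatrix {n : ℕ} (hn : 2 ≤ n)
    {u : EuclideanSpace ℝ (Fin n) → ℝ} (hu : ContDiff ℝ 2 u) (x : EuclideanSpace ℝ (Fin n))
    (hpos : ∀ l, 1 ≤ l → l ≤ n → 0 < symFunc (weingartenMatrix u x) l)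
    (heq : symFunc (weingartenMatrix u x) n * Real.sqrt (1 + gradNormSq u x) =
      symFunc (weingartenMatrix u x) (n - 1)) (i : Fin n) :
    1 + partialDeriv1 u x i ^ 2 ≤ hessianMatrix u x i i := by
  set p := partialDeriv1 u x with hp
  set w := Real.sqrt (1 + gradNormSq u x) with hwdef
  have hg : 0 ≤ gradNormSq u x := Finset.sum_nonneg fun i _ => sq_nonneg _
  have hw : 0 < w := Real.sqrt_pos.2 (by linarith)
  have hw1 : 0 < w + 1 := by linarith
  have hsum : ∑ i, p i ^ 2 = w ^ 2 - 1 := by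
    rw [hwdef, Real.sq_sqrt (by linarith), gradNormSq]; ring
  have hsymm : ∀ a : ℝ, (1 + a • Matrix.vecMulVec p p)ᵀ = 1 + a • Matrix.vecMulVec p p := by
    intro a
    rw [Matrix.transpose_add, Matrix.transpose_smul, Matrix.transpose_one,
      Matrix.transpose_vecMulVec]
  have hMM : (1 + (1 / (w + 1)) • Matrix.vecMulVec p p) * (1 + (1 / (w + 1)) • Matrix.vecMulVec p p)
      = 1 + Matrix.vecMulVec p p := by
    rw [one_add_smul_vecMulVec_mul, hsum]
    have : 1 / (w + 1) + 1 / (w + 1) + 1 / (w + 1) * (1 / (w + 1)) * (w ^ 2 - 1) = 1 := by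
      field_simp; ring
    rw [this, one_smul]
  have hMN : (1 + (1 / (w + 1)) • Matrix.vecMulVec p p) *
      (1 + (-1 / (w * (w + 1))) • Matrix.vecMulVec p p) = 1 := by
    rw [one_add_smul_vecMulVec_mul, hsum]
    have : 1 / (w + 1) + -1 / (w * (w + 1)) + 1 / (w + 1) * (-1 / (w * (w + 1))) * (w ^ 2 - 1)
        = 0 := by
      field_simp; ring
    rw [this, zero_smul, add_zero]
  have hNN : (1 + (-1 / (w * (w + 1))) • Matrix.vecMulVec p p) *
      (1 + (-1 / (w * (w + 1))) • Matrix.vecMulVec p p) =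
        1 + (-1 / w ^ 2) • Matrix.vecMulVec p p := by
    rw [one_add_smul_vecMulVec_mul, hsum]
    congr 2
    field_simp; ring
  have hW : weingartenMatrix u x = w⁻¹ • ((1 + (-1 / (w * (w + 1))) • Matrix.vecMulVec p p) *
      (1 + (-1 / (w * (w + 1))) • Matrix.vecMulVec p p) * hessianMatrix u x) := by
    rw [hNN, ← smul_mul_assoc]
    ext i j
    rw [weingartenMatrix, Matrix.of_apply, Matrix.mul_apply]
    refine Finset.sum_congr rfl fun k _ => ?_
    congr 1
    simp only [Matrix.smul_apply, Matrix.add_apply, Matrix.one_apply, Matrix.vecMulVec_apply,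
      smul_eq_mul, ← hp, ← hwdef]
    field_simp
    ring
  rw [hW] at hpos heq
  have h := le_of_symFunc_eq hn hw (hsymm _) (hsymm _) (hessianMatrix_transpose hu x) hMN
    hpos heq i
  rw [hMM] at h
  simpa [Matrix.vecMulVec_apply, sq] using h

/-- The Riccati inequality `deriv g ≥ 1 + g²` has no solution on the whole line. -/
lemma not_forall_one_add_sq_le_deriv {g g' : ℝ → ℝ} (hg : ∀ t, HasDerivAt g (g' t) t) :
    ¬ ∀ t, 1 + g t ^ 2 ≤ g' t := by
  intro h
  have hd : ∀ t, HasDerivAt (fun t => Real.arctan (g t)) (1 / (1 + g t ^ 2) * g' t) t :=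
    fun t => (hg t).arctan
  have hle := mul_sub_le_image_sub_of_le_deriv (C := 1) (fun t => (hd t).differentiableAt)
    (fun t => by
      rw [(hd t).deriv, one_div_mul_eq_div, one_le_div (by positivity)]
      exact h t) (show (0 : ℝ) ≤ 4 by norm_num)
  have h1 := Real.arctan_lt_pi_div_two (g 4)
  have h2 := Real.neg_pi_div_two_lt_arctan (g 0)
  linarith [Real.pi_lt_four]

/-- Theorem 3: non-existence of entire graphical `Q_{n-1}`-translators in `ℝ^{n+1}`
with principal curvatures in the cone `Γ_n`.  There is no `C²` function
`u : ℝⁿ → ℝ` such that `S_l(W(u)) > 0` for `l = 1, …, n` everywhere and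
`S_n(W(u)) √(1+|∇u|²) = S_{n-1}(W(u))` everywhere. -/
theorem no_entire_q_translator (n : ℕ) (hn : 2 ≤ n) :
    ¬ ∃ u : EuclideanSpace ℝ (Fin n) → ℝ, ContDiff ℝ 2 u ∧
      ∀ x : EuclideanSpace ℝ (Fin n),
        (∀ l, 1 ≤ l → l ≤ n → 0 < symFunc (weingartenMatrix u x) l) ∧
        symFunc (weingartenMatrix u x) n * Real.sqrt (1 + gradNormSq u x) =
          symFunc (weingartenMatrix u x) (n - 1) := by
  rintro ⟨u, hu, h⟩
  let i : Fin n := ⟨0, by omega⟩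
  let e : EuclideanSpace ℝ (Fin n) := EuclideanSpace.single i 1
  have hdiff : Differentiable ℝ fun y => fderiv ℝ u y e := fun x =>
    (((hu.fderiv_right (m := 1) (by norm_num)).differentiable (by norm_num)) x).clm_apply
      (differentiableAt_const _)
  have hline : ∀ t : ℝ, HasDerivAt (fun t : ℝ => t • e) e t := fun t => by
    simpa using (hasDerivAt_id t).smul_const e
  refine not_forall_one_add_sq_le_deriv (g := fun t => partialDeriv1 u (t • e) i)
    (g' := fun t => hessianMatrix u (t • e) i i) (fun t => ?_) fun t =>
    one_add_partialDeriv1_sq_le_hessianMatrix hn hu _ (h _).1 (h _).2 i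
  exact (hdiff (t • e)).hasFDerivAt.comp_hasDerivAt t (hline t)
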